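/- The number of monotone Boolean functions of 8 variables that are fixed points of the transposition of Fin 8 swapping indices 0 and 1 equals 101627867809333596. -/

import Mathlib

/-- Binary tries holding finitely supported functions on infinite binary words.
`leaf v` carries the value `v` at the word which is zero from this point on. -/
inductive Trie
  | nil
  | leaf (v : ℕ)
  | node (l r : Trie)

namespace Trie

/-- The subtrie of words starting with `false`. -/
noncomputable def left (t : Trie) : Trie :=
  Trie.rec nil (fun v => leaf v) (fun l _ _ _ => l) t

/-- The subtrie of words starting with `true`. -/
noncomputable def right (t : Trie) : Trie :=
  Trie.rec nil (fun _ => nil) (fun _ r _ _ => r) t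

/-- The value at the zero word. -/
noncomputable def zeroVal (t : Trie) : ℕ :=
  Trie.rec 0 (fun v => v) (fun _ _ il _ => il) t

/-- Adds `a` to the value at the zero word. -/
noncomputable def addZero (a : ℕ) (t : Trie) : Trie :=
  Trie.rec (leaf a) (fun b => leaf (Nat.add a b)) (fun _ r il _ => node il r) t

/-- Pointwise addition. -/
noncomputable def add (s : Trie) : Trie → Trie :=
  Trie.rec (fun t => t) (fun a t => addZero a t)
    (fun l r il ir t => Trie.rec (node l r) (fun v => node (addZero v l) r)
      (fun l' r' _ _ => node (il l') (ir r')) t) s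

/-- The down-set sums of `t`, at the words of the trie `b`. -/
noncomputable def zeta (b : Trie) : Trie → Trie :=
  Trie.rec (fun _ => nil) (fun _ t => leaf (zeroVal t))
    (fun _ _ il ir t => node (il (left t)) (ir (add (right t) (left t)))) b

/-- Pointwise bitwise conjunction. -/
noncomputable def zipLand (s : Trie) : Trie → Trie :=
  Trie.rec (fun _ => nil) (fun a t => leaf (Nat.land a (zeroVal t)))
    (fun _ _ il ir t => node (il (left t)) (ir (right t))) s

/-- The sum of `f (s x) (t x)` over the words `x` of `s`. -/
noncomputable def sumZip (f : ℕ → ℕ → ℕ) (s : Trie) : Trie → ℕ :=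
  Trie.rec (fun _ => 0) (fun a t => f a (zeroVal t))
    (fun _ _ il ir t => Nat.add (il (left t)) (ir (right t))) s

/-- A node, contracted if it only contains the zero word. -/
noncomputable def mkNode (l r : Trie) : Trie :=
  Trie.rec (Trie.rec nil (fun v => leaf v) (fun a b _ _ => node (node a b) nil) l)
    (fun v => node l (leaf v)) (fun a b _ _ => node l (node a b)) r

/-- The words of length `n` continuing the prefix `p` of length `k`, where position `j` can only be
occupied if all positions in the bit mask `u j` are. -/
noncomputable def build (u : ℕ → ℕ) (n : ℕ) : ℕ → ℕ → Trie :=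
  Nat.rec (fun _ _ => leaf 0) (fun _ ih k p => mkNode (ih (Nat.succ k) p)
    (Bool.rec nil (ih (Nat.succ k) (Nat.add p (Nat.pow 2 k)))
      (Nat.beq (Nat.land p (u k)) (u k)))) n

/-- The trie of the words of `b`, with `m` cut down by the masks `c k` at the occupied positions. -/
noncomputable def maskTrue (c : ℕ → ℕ) (b : Trie) : ℕ → ℕ → Trie :=
  Trie.rec (fun _ _ => nil) (fun _ _ m => leaf m)
    (fun _ _ il ir k m => node (il (Nat.succ k) m) (ir (Nat.succ k) (Nat.land m (c k)))) b

/-- The trie of the words of `b`, with `m` cut down by the masks `c k` at the free positions;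
`d k` is the mask for all positions from `k` on. -/
noncomputable def maskFalse (c d : ℕ → ℕ) (b : Trie) : ℕ → ℕ → Trie :=
  Trie.rec (fun _ _ => nil) (fun _ k m => leaf (Nat.land m (d k)))
    (fun _ _ il ir k m => node (il (Nat.succ k) (Nat.land m (c k))) (ir (Nat.succ k) m)) b

/-- The value `1` at the word of the `n` lowest binary digits of `c`. -/
noncomputable def single (n : ℕ) : ℕ → Trie :=
  Nat.rec (fun _ => leaf 1) (fun _ ih c => Bool.rec
    (Bool.rec (node (ih (Nat.div c 2)) nil) (node nil (ih (Nat.div c 2))) (Nat.beq (Nat.mod c 2) 1))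
    (leaf 1) (Nat.beq c 0)) n

/-- The multiplicities of the images under `f` of the words of `b`, read as binary numbers. -/
noncomputable def pushforward (f : ℕ → ℕ) (b : Trie) : ℕ → ℕ → Trie :=
  Trie.rec (fun _ _ => nil) (fun _ _ c => single 32 (f c))
    (fun _ _ il ir k c => add (il (Nat.succ k) c) (ir (Nat.succ k) (Nat.add c (Nat.pow 2 k)))) b

/-- The words of a trie, read as binary numbers, together with their values. -/
noncomputable def toList (t : Trie) : ℕ → ℕ → List (ℕ × ℕ) → List (ℕ × ℕ) :=
  Trie.rec (fun _ _ acc => acc) (fun v _ c acc => (c, v) :: acc)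
    (fun _ _ il ir k c acc =>
      il (Nat.succ k) c (ir (Nat.succ k) (Nat.add c (Nat.pow 2 k)) acc)) t

end Trie


section Words

/-- Prepends a letter to an infinite binary word. -/
def consWord (b : Bool) (x : ℕ → Bool) : ℕ → Bool
  | 0 => b
  | k + 1 => x k

theorem consWord_surjective (x : ℕ → Bool) : ∃ b y, x = consWord b y :=
  ⟨x 0, fun k => x (k + 1), by funext k; cases k <;> rfl⟩

theorem consWord_inj {a b : Bool} {x y : ℕ → Bool} :
    consWord a x = consWord b y ↔ a = b ∧ x = y := by
  refine ⟨fun h => ⟨congrFun h 0, funext fun k => congrFun h (k + 1)⟩, ?_⟩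
  rintro ⟨rfl, rfl⟩
  rfl

theorem consWord_le {a b : Bool} {x y : ℕ → Bool} :
    consWord a x ≤ consWord b y ↔ a ≤ b ∧ x ≤ y := by
  refine ⟨fun h => ⟨h 0, fun k => h (k + 1)⟩, ?_⟩
  rintro ⟨h, h'⟩ (_ | k)
  · exact h
  · exact h' k

theorem consWord_eq_bot {b : Bool} {x : ℕ → Bool} : consWord b x = ⊥ ↔ b = false ∧ x = ⊥ := by
  have h : consWord false ⊥ = ⊥ := by funext k; cases k <;> rfl
  rw [← h, consWord_inj, h]

end Words

namespace Trie

open scoped Classical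

/-- The words of a trie. -/
noncomputable def words (t : Trie) : Finset (ℕ → Bool) :=
  Trie.rec ∅ (fun _ => {⊥})
    (fun _ _ l r => l.image (consWord false) ∪ r.image (consWord true)) t

/-- The value of a trie at a word. -/
noncomputable def get (t : Trie) : (ℕ → Bool) → ℕ :=
  Trie.rec (fun _ => 0) (fun v x => if x = ⊥ then v else 0)
    (fun _ _ l r x => bif x 0 then r (fun k => x (k + 1)) else l (fun k => x (k + 1))) t

@[simp] theorem words_nil : words nil = ∅ := rfl
@[simp] theorem words_leaf (v : ℕ) : words (leaf v) = {⊥} := rfl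
@[simp] theorem get_nil (x : ℕ → Bool) : get nil x = 0 := rfl
@[simp] theorem get_leaf_bot (v : ℕ) : get (leaf v) ⊥ = v := if_pos rfl

theorem get_leaf (v : ℕ) (x : ℕ → Bool) : get (leaf v) x = if x = ⊥ then v else 0 := rfl

@[simp] theorem get_node_false (l r : Trie) (x : ℕ → Bool) :
    get (node l r) (consWord false x) = get l x := rfl

@[simp] theorem get_node_true (l r : Trie) (x : ℕ → Bool) :
    get (node l r) (consWord true x) = get r x := rfl

@[simp] theorem consWord_false_mem_words (l r : Trie) (x : ℕ → Bool) :
    consWord false x ∈ words (node l r) ↔ x ∈ words l := by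
  simp [words, consWord_inj]

@[simp] theorem consWord_true_mem_words (l r : Trie) (x : ℕ → Bool) :
    consWord true x ∈ words (node l r) ↔ x ∈ words r := by
  simp [words, consWord_inj]

theorem sum_words_node (l r : Trie) (f : (ℕ → Bool) → ℕ) :
    ∑ x ∈ words (node l r), f x =
      ∑ x ∈ words l, f (consWord false x) + ∑ x ∈ words r, f (consWord true x) := by
  have h : words (node l r) =
      (words l).image (consWord false) ∪ (words r).image (consWord true) := by
    ext x
    simp [words]
  rw [h, Finset.sum_union, Finset.sum_image, Finset.sum_image]
  · exact fun x _ y _ h => (consWord_inj.1 h).2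
  · exact fun x _ y _ h => (consWord_inj.1 h).2
  · rw [Finset.disjoint_left]
    simp only [Finset.mem_image, not_exists, not_and]
    rintro _ ⟨x, -, rfl⟩ y - h
    simp [consWord_inj] at h

theorem get_eq_zero {t : Trie} {x : ℕ → Bool} (h : x ∉ words t) : get t x = 0 := by
  induction t generalizing x with
  | nil => rfl
  | leaf v => simpa [get_leaf] using fun h' => absurd h' (by simpa using h)
  | node l r hl hr =>
    obtain ⟨_ | _, y, rfl⟩ := consWord_surjective x
    · exact hl (x := y) fun h' => h (by simpa using h')
    · exact hr (x := y) fun h' => h (by simpa using h')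

@[simp] theorem get_left (t : Trie) (x : ℕ → Bool) :
    get (left t) x = get t (consWord false x) := by
  cases t with
  | nil => rfl
  | leaf v => simp [left, get_leaf, consWord_eq_bot]
  | node l r => rfl

@[simp] theorem get_right (t : Trie) (x : ℕ → Bool) :
    get (right t) x = get t (consWord true x) := by
  cases t with
  | nil => rfl
  | leaf v => simp [right, get_leaf, consWord_eq_bot]
  | node l r => rfl

theorem consWord_false_bot : consWord false ⊥ = ⊥ := consWord_eq_bot.2 ⟨rfl, rfl⟩

theorem zeroVal_eq (t : Trie) : zeroVal t = get t ⊥ := by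
  induction t with
  | nil => rfl
  | leaf v => simp [zeroVal]
  | node l r hl hr => rw [← consWord_false_bot, get_node_false, ← hl]; rfl

theorem get_addZero (a : ℕ) (t : Trie) (x : ℕ → Bool) :
    get (addZero a t) x = (if x = ⊥ then a else 0) + get t x := by
  induction t generalizing x with
  | nil => rfl
  | leaf v =>
    change get (leaf (a + v)) x = _
    simp only [get_leaf]
    split_ifs <;> rfl
  | node l r hl hr =>
    change get (node (addZero a l) r) x = _
    obtain ⟨_ | _, y, rfl⟩ := consWord_surjective x
    · simp [hl, consWord_eq_bot]
    · simp [consWord_eq_bot]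

theorem get_add (s t : Trie) (x : ℕ → Bool) : get (add s t) x = get s x + get t x := by
  induction s generalizing t x with
  | nil => exact (zero_add _).symm
  | leaf v => exact get_addZero v t x
  | node l r hl hr =>
    cases t with
    | nil => rfl
    | leaf v =>
      change get (node (addZero v l) r) x = _
      obtain ⟨_ | _, y, rfl⟩ := consWord_surjective x
      · simp [get_addZero, get_leaf, consWord_eq_bot, add_comm]
      · simp [get_leaf, consWord_eq_bot]
    | node l' r' =>
      change get (node (add l l') (add r r')) x = _
      obtain ⟨_ | _, y, rfl⟩ := consWord_surjective x
      · exact hl l' y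
      · exact hr r' y

/-- The sum of the values of a trie at the words below `x`. -/
noncomputable def lowerSum (t : Trie) (x : ℕ → Bool) : ℕ :=
  ∑ y ∈ words t, if y ≤ x then get t y else 0

theorem lowerSum_eq {t : Trie} {S : Finset (ℕ → Bool)} (h : words t ⊆ S) (x : ℕ → Bool) :
    lowerSum t x = ∑ y ∈ S, if y ≤ x then get t y else 0 :=
  Finset.sum_subset h fun y _ hy => by simp [get_eq_zero hy]

theorem lowerSum_add (s t : Trie) (x : ℕ → Bool) :
    lowerSum (add s t) x = lowerSum s x + lowerSum t x := by
  rw [lowerSum_eq (S := words (add s t) ∪ (words s ∪ words t)) (by grind),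
    lowerSum_eq (t := s) (S := words (add s t) ∪ (words s ∪ words t)) (by grind),
    lowerSum_eq (t := t) (S := words (add s t) ∪ (words s ∪ words t)) (by grind),
    ← Finset.sum_add_distrib]
  refine Finset.sum_congr rfl fun y _ => ?_
  rw [get_add]
  split_ifs <;> rfl

theorem lowerSum_bot (t : Trie) : lowerSum t ⊥ = get t ⊥ := by
  rw [lowerSum_eq (Finset.subset_insert ⊥ (words t))]
  simp [le_bot_iff]

theorem lowerSum_consWord_false (t : Trie) (x : ℕ → Bool) :
    lowerSum t (consWord false x) = lowerSum (left t) x := by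
  cases t with
  | nil => rfl
  | leaf v => simp [lowerSum, left]
  | node l r => simp [lowerSum, left, sum_words_node, consWord_le, -Bool.not_eq_true]

theorem lowerSum_consWord_true (t : Trie) (x : ℕ → Bool) :
    lowerSum t (consWord true x) = lowerSum (right t) x + lowerSum (left t) x := by
  cases t with
  | nil => rfl
  | leaf v => simp [lowerSum, left, right]
  | node l r => simp [lowerSum, left, right, sum_words_node, consWord_le, add_comm]

theorem get_zeta {b : Trie} (t : Trie) {x : ℕ → Bool} (hx : x ∈ words b) :
    get (zeta b t) x = lowerSum t x := by
  induction b generalizing t x with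
  | nil => simp at hx
  | leaf v =>
    obtain rfl : x = ⊥ := by simpa using hx
    rw [lowerSum_bot, ← zeroVal_eq t]
    exact get_leaf_bot (zeroVal t)
  | node l r hl hr =>
    change get (node (zeta l (left t)) (zeta r (add (right t) (left t)))) x = _
    obtain ⟨_ | _, y, rfl⟩ := consWord_surjective x
    · rw [get_node_false, hl _ (by simpa using hx), lowerSum_consWord_false]
    · rw [get_node_true, hr _ (by simpa using hx), lowerSum_consWord_true, lowerSum_add]

theorem words_node (l r l' r' : Trie) (hl : words l = words l') (hr : words r = words r') :
    words (node l r) = words (node l' r') := by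
  ext x
  obtain ⟨_ | _, y, rfl⟩ := consWord_surjective x <;> simp [hl, hr]

theorem words_zeta (b t : Trie) : words (zeta b t) = words b := by
  induction b generalizing t with
  | nil => rfl
  | leaf v => rfl
  | node l r hl hr => exact words_node _ _ _ _ (hl _) (hr _)

theorem words_zipLand (s t : Trie) : words (zipLand s t) = words s := by
  induction s generalizing t with
  | nil => rfl
  | leaf v => rfl
  | node l r hl hr => exact words_node _ _ _ _ (hl _) (hr _)

theorem get_zipLand (s t : Trie) {x : ℕ → Bool} (hx : x ∈ words s) :
    get (zipLand s t) x = get s x &&& get t x := by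
  induction s generalizing t x with
  | nil => simp at hx
  | leaf v =>
    obtain rfl : x = ⊥ := by simpa using hx
    rw [get_leaf_bot, ← zeroVal_eq t]
    exact get_leaf_bot (v &&& zeroVal t)
  | node l r hl hr =>
    change get (node (zipLand l (left t)) (zipLand r (right t))) x = _
    obtain ⟨_ | _, y, rfl⟩ := consWord_surjective x
    · rw [get_node_false, hl _ (by simpa using hx), get_left, get_node_false]
    · rw [get_node_true, hr _ (by simpa using hx), get_right, get_node_true]

theorem sumZip_eq (f : ℕ → ℕ → ℕ) (s t : Trie) :
    sumZip f s t = ∑ x ∈ words s, f (get s x) (get t x) := by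
  induction s generalizing t with
  | nil => rfl
  | leaf v => simp [sumZip, zeroVal_eq]
  | node l r hl hr =>
    change sumZip f l (left t) + sumZip f r (right t) = _
    simp [hl, hr, sum_words_node]

theorem words_mkNode (l r : Trie) : words (mkNode l r) = words (node l r) := by
  cases r with
  | leaf | node => rfl
  | nil =>
    cases l with
    | node => rfl
    | nil => simp [mkNode, words]
    | leaf v => simp [mkNode, words, consWord_false_bot]

theorem words_maskTrue (c : ℕ → ℕ) (b : Trie) (k m : ℕ) : words (maskTrue c b k m) = words b := by
  induction b generalizing k m with
  | nil => rfl
  | leaf v => rfl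
  | node l r hl hr => exact words_node _ _ _ _ (hl _ _) (hr _ _)

theorem words_maskFalse (c d : ℕ → ℕ) (b : Trie) (k m : ℕ) :
    words (maskFalse c d b k m) = words b := by
  induction b generalizing k m with
  | nil => rfl
  | leaf v => rfl
  | node l r hl hr => exact words_node _ _ _ _ (hl _ _) (hr _ _)

end Trie

section Packing

/-- The base of the positional system in which lists of numbers are packed. -/
noncomputable def laneBase : ℕ := Nat.pow 2 80

/-- The number whose digits in base `laneBase` are the values of `f` on a list. -/
noncomputable def pack {α : Type} (f : α → ℕ) (l : List α) : ℕ :=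
  List.rec 0 (fun a _ ih => Nat.add (f a) (Nat.mul laneBase ih)) l

/-- The bit mask selecting the digits where `p` holds. -/
noncomputable def mask {α : Type} (p : α → Bool) (l : List α) : ℕ :=
  pack (fun a => bif p a then Nat.sub laneBase 1 else 0) l

/-- The coefficient extracting the inner product of two lists of length `n`, the second of which is
packed in reverse order. -/
noncomputable def innerCoeff (n a b : ℕ) : ℕ :=
  Nat.mod (Nat.div (Nat.mul (Nat.mul a b) laneBase) (Nat.pow laneBase n)) laneBase

variable {α : Type}

theorem laneBase_pos : 0 < laneBase := Nat.two_pow_pos 80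

theorem pack_cons (f : α → ℕ) (a : α) (l : List α) :
    pack f (a :: l) = f a + laneBase * pack f l := rfl

theorem pack_append (f : α → ℕ) (l l' : List α) :
    pack f (l ++ l') = pack f l + laneBase ^ l.length * pack f l' := by
  induction l with
  | nil => simp [pack]
  | cons a l ih =>
    rw [List.cons_append, pack_cons, pack_cons, ih, List.length_cons]
    ring

theorem pack_zero (l : List α) : pack (fun _ => 0) l = 0 := by
  induction l with
  | nil => rfl
  | cons a l ih => simp [pack_cons, ih]

theorem pack_add (f g : α → ℕ) (l : List α) :
    pack (fun a => f a + g a) l = pack f l + pack g l := by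
  induction l with
  | nil => rfl
  | cons a l ih =>
    rw [pack_cons, pack_cons, pack_cons, ih]
    ring

theorem pack_sum {ι : Type*} (S : Finset ι) (f : ι → α → ℕ) (l : List α) :
    pack (fun a => ∑ i ∈ S, f i a) l = ∑ i ∈ S, pack (f i) l := by
  classical
  induction S using Finset.induction_on with
  | empty => simpa using pack_zero l
  | insert i S hi ih => simp only [Finset.sum_insert hi, pack_add, ih]

theorem pack_ite (p : Prop) [Decidable p] (f : α → ℕ) (l : List α) :
    pack (fun a => if p then f a else 0) l = if p then pack f l else 0 := by
  split_ifs
  · rfl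
  · exact pack_zero l

theorem pack_congr {f g : α → ℕ} {l : List α} (h : ∀ a ∈ l, f a = g a) : pack f l = pack g l := by
  induction l with
  | nil => rfl
  | cons a l ih =>
    rw [pack_cons, pack_cons, h a (by simp), ih fun b hb => h b (by simp [hb])]

theorem land_add_two_pow_mul {n a c : ℕ} (ha : a < 2 ^ n) (hc : c < 2 ^ n) (b d : ℕ) :
    (a + 2 ^ n * b) &&& (c + 2 ^ n * d) = (a &&& c) + 2 ^ n * (b &&& d) := by
  refine Nat.eq_of_testBit_eq fun i => ?_
  rw [add_comm a, add_comm c, add_comm (a &&& c), Nat.testBit_and,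
    Nat.testBit_two_pow_mul_add _ ha, Nat.testBit_two_pow_mul_add _ hc,
    Nat.testBit_two_pow_mul_add _ (lt_of_le_of_lt Nat.and_le_left ha)]
  split_ifs <;> rw [Nat.testBit_and]

theorem pack_land_mask {f : α → ℕ} (p : α → Bool) {l : List α} (hf : ∀ a ∈ l, f a < laneBase) :
    pack f l &&& mask p l = pack (fun a => if p a = true then f a else 0) l := by
  induction l with
  | nil => exact Nat.zero_and _
  | cons a l ih =>
    rw [mask, pack_cons, pack_cons, pack_cons, ← ih fun b hb => hf b (by simp [hb]), ← mask]
    have ha : f a < 2 ^ 80 := hf a (by simp)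
    have h : (bif p a then Nat.sub laneBase 1 else 0) < 2 ^ 80 := by
      cases p a
      · exact Nat.two_pow_pos 80
      · exact Nat.sub_lt (Nat.two_pow_pos 80) one_pos
    refine (land_add_two_pow_mul ha h _ _).trans ?_
    congr 1
    cases p a
    · exact Nat.and_zero _
    · exact (Nat.and_two_pow_sub_one_eq_mod _ _).trans (Nat.mod_eq_of_lt ha)

theorem pack_reverse_mul_le (g : α → ℕ) (l : List α) :
    pack g l.reverse * laneBase ≤ (l.map g).sum * laneBase ^ l.length := by
  induction l with
  | nil => simp [pack]
  | cons a l ih =>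
    rw [List.reverse_cons, pack_append, List.length_reverse, List.map_cons, List.sum_cons,
      List.length_cons, pow_succ]
    have h : pack g [a] = g a := rfl
    have hX := laneBase_pos
    calc (pack g l.reverse + laneBase ^ l.length * pack g [a]) * laneBase
        = pack g l.reverse * laneBase + g a * (laneBase ^ l.length * laneBase) := by rw [h]; ring
      _ ≤ (l.map g).sum * laneBase ^ l.length * laneBase
            + g a * (laneBase ^ l.length * laneBase) := by
          exact Nat.add_le_add_right (ih.trans (Nat.le_mul_of_pos_right _ hX)) _
      _ = _ := by ring

theorem exists_pack_mul_pack_reverse (f g : α → ℕ) (l : List α) :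
    ∃ lo hi, pack f l * pack g l.reverse * laneBase =
        lo + laneBase ^ l.length * ((l.map fun a => f a * g a).sum + laneBase * hi) ∧
      lo * laneBase ≤ (l.map f).sum * (l.map g).sum * laneBase ^ l.length := by
  induction l with
  | nil => exact ⟨0, 0, by simp [pack], by simp⟩
  | cons a l ih =>
    obtain ⟨lo, hi, h, hlo⟩ := ih
    refine ⟨f a * pack g l.reverse * laneBase + laneBase * lo, hi + pack f l * g a, ?_, ?_⟩
    · have h' : pack g (a :: l).reverse = pack g l.reverse + laneBase ^ l.length * g a := by
        rw [List.reverse_cons, pack_append, List.length_reverse]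
        rfl
      rw [h', pack_cons, List.map_cons, List.sum_cons, List.length_cons]
      linear_combination laneBase * h
    · have := pack_reverse_mul_le g l
      rw [List.map_cons, List.sum_cons, List.map_cons, List.sum_cons, List.length_cons]
      calc (f a * pack g l.reverse * laneBase + laneBase * lo) * laneBase
          = (f a * (pack g l.reverse * laneBase) + lo * laneBase) * laneBase := by ring
        _ ≤ (f a * ((l.map g).sum * laneBase ^ l.length)
              + (l.map f).sum * (l.map g).sum * laneBase ^ l.length) * laneBase := by gcongr
        _ = (f a + (l.map f).sum) * (l.map g).sum * laneBase ^ (l.length + 1) := by ring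
        _ ≤ _ := by gcongr; omega

theorem sum_map_mul_le (f g : α → ℕ) (l : List α) :
    (l.map fun a => f a * g a).sum ≤ (l.map f).sum * (l.map g).sum := by
  induction l with
  | nil => simp
  | cons a l ih =>
    simp only [List.map_cons, List.sum_cons]
    nlinarith [Nat.zero_le (f a * (l.map g).sum), Nat.zero_le ((l.map f).sum * g a)]

theorem innerCoeff_pack {f g : α → ℕ} {l : List α}
    (h : (l.map f).sum * (l.map g).sum < laneBase) :
    innerCoeff l.length (pack f l) (pack g l.reverse) = (l.map fun a => f a * g a).sum := by
  obtain ⟨lo, hi, he, hlo⟩ := exists_pack_mul_pack_reverse f g l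
  have hX := laneBase_pos
  have hlt : lo < laneBase ^ l.length := by
    refine lt_of_mul_lt_mul_right (hlo.trans_lt ?_) hX.le
    rw [mul_comm]
    gcongr
  change pack f l * pack g l.reverse * laneBase / laneBase ^ l.length % laneBase = _
  rw [he, Nat.add_mul_div_left _ _ (pow_pos hX _), Nat.div_eq_of_lt hlt, zero_add,
    Nat.add_mul_mod_self_left, Nat.mod_eq_of_lt ((sum_map_mul_le f g l).trans_lt h)]

end Packing

namespace Trie

open scoped Classical

/-- The binary digits of `c` from position `k` on, as a word. -/
def digits (k c : ℕ) : ℕ → Bool := fun j => c.testBit (k + j)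

theorem digits_eq_consWord (k c : ℕ) : digits k c = consWord (c.testBit k) (digits (k + 1) c) := by
  funext j
  cases j with
  | zero => rfl
  | succ j => simp [digits, consWord, add_assoc, add_comm 1]

/-- The trie of the values `pack f R`, restricted at a word to the elements of `R` above it. -/
noncomputable def aboveTable (R : List (ℕ × ℕ)) (f : ℕ × ℕ → ℕ) (b : Trie) : Trie :=
  maskTrue (fun k => mask (fun a => Nat.testBit a.1 k) R) b 0 (pack f R)

/-- The trie of the values `pack f R`, restricted at a word to the elements of `R` below it. -/
noncomputable def belowTable (R : List (ℕ × ℕ)) (f : ℕ × ℕ → ℕ) (b : Trie) : Trie :=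
  maskFalse (fun k => mask (fun a => !(Nat.testBit a.1 k)) R)
    (fun k => mask (fun a => Nat.beq (Nat.shiftRight a.1 k) 0) R) b 0 (pack f R)

theorem digits_le_bot (k c : ℕ) : digits k c ≤ ⊥ ↔ Nat.beq (Nat.shiftRight c k) 0 = true := by
  rw [Nat.beq_eq, le_bot_iff]
  constructor
  · intro h
    refine Nat.eq_of_testBit_eq fun j => ?_
    rw [Nat.zero_testBit]
    exact (Nat.testBit_shiftRight c).trans (congrFun h j)
  · intro h
    funext j
    refine (Nat.testBit_shiftRight c).symm.trans ?_
    change (Nat.shiftRight c k).testBit j = _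
    rw [h, Nat.zero_testBit]
    rfl

theorem get_maskTrue (R : List (ℕ × ℕ)) {f : ℕ × ℕ → ℕ} (hf : ∀ a ∈ R, f a < laneBase) {b : Trie}
    (k : ℕ) {x : ℕ → Bool} (hx : x ∈ words b) :
    get (maskTrue (fun k => mask (fun a => Nat.testBit a.1 k) R) b k (pack f R)) x =
      pack (fun a => if x ≤ digits k a.1 then f a else 0) R := by
  induction b generalizing f k x with
  | nil => simp at hx
  | leaf v =>
    obtain rfl : x = ⊥ := by simpa using hx
    simp only [bot_le, if_true]
    exact get_leaf_bot (pack f R)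
  | node l r hl hr =>
    change get (node (maskTrue _ l (k + 1) (pack f R)) (maskTrue _ r (k + 1) (pack f R &&& _))) x = _
    obtain ⟨_ | _, y, rfl⟩ := consWord_surjective x
    · rw [get_node_false, hl hf _ (by simpa using hx)]
      refine pack_congr fun a _ => ?_
      rw [digits_eq_consWord k, consWord_le]
      simp
    · rw [get_node_true, pack_land_mask _ hf, hr _ _ (by simpa using hx)]
      · refine pack_congr fun a _ => ?_
        rw [digits_eq_consWord k, consWord_le, ← ite_and]
        simp [Bool.le_iff_imp, and_comm]
      · intro a ha
        split_ifs
        exacts [hf a ha, laneBase_pos]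

theorem get_maskFalse (R : List (ℕ × ℕ)) {f : ℕ × ℕ → ℕ} (hf : ∀ a ∈ R, f a < laneBase) {b : Trie}
    (k : ℕ) {x : ℕ → Bool} (hx : x ∈ words b) :
    get (maskFalse (fun k => mask (fun a => !(Nat.testBit a.1 k)) R)
        (fun k => mask (fun a => Nat.beq (Nat.shiftRight a.1 k) 0) R) b k (pack f R)) x =
      pack (fun a => if digits k a.1 ≤ x then f a else 0) R := by
  induction b generalizing f k x with
  | nil => simp at hx
  | leaf v =>
    obtain rfl : x = ⊥ := by simpa using hx
    simp only [digits_le_bot]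
    rw [← pack_land_mask _ hf]
    exact get_leaf_bot _
  | node l r hl hr =>
    change get (node (maskFalse _ _ l (k + 1) (pack f R &&& _))
      (maskFalse _ _ r (k + 1) (pack f R))) x = _
    obtain ⟨_ | _, y, rfl⟩ := consWord_surjective x
    · rw [get_node_false, pack_land_mask _ hf, hl _ _ (by simpa using hx)]
      · refine pack_congr fun a _ => ?_
        rw [digits_eq_consWord k, consWord_le, ← ite_and]
        simp [Bool.le_iff_imp, and_comm]
      · intro a ha
        split_ifs
        exacts [hf a ha, laneBase_pos]
    · rw [get_node_true, hr hf _ (by simpa using hx)]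
      refine pack_congr fun a _ => ?_
      rw [digits_eq_consWord k, consWord_le]
      simp [Bool.le_true]

end Trie

namespace Trie

open scoped Classical

/-- The trie `t` has the words of `b`, and its value at a word `x` packs the values of `v x`. -/
def IsTable (b : Trie) (R : List (ℕ × ℕ)) (v : (ℕ → Bool) → ℕ × ℕ → ℕ) (t : Trie) : Prop :=
  words t = words b ∧ ∀ x ∈ words b, get t x = pack (v x) R

variable {b t : Trie} {R : List (ℕ × ℕ)} {v : (ℕ → Bool) → ℕ × ℕ → ℕ}

theorem isTable_aboveTable {f : ℕ × ℕ → ℕ} (hf : ∀ a ∈ R, f a < laneBase) :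
    IsTable b R (fun x a => if x ≤ digits 0 a.1 then f a else 0) (aboveTable R f b) :=
  ⟨words_maskTrue _ _ _ _, fun _ hx => get_maskTrue R hf 0 hx⟩

theorem isTable_belowTable {f : ℕ × ℕ → ℕ} (hf : ∀ a ∈ R, f a < laneBase) :
    IsTable b R (fun x a => if digits 0 a.1 ≤ x then f a else 0) (belowTable R f b) :=
  ⟨words_maskFalse _ _ _ _ _, fun _ hx => get_maskFalse R hf 0 hx⟩

theorem IsTable.zeta (h : IsTable b R v t) :
    IsTable b R (fun x a => ∑ y ∈ words b, if y ≤ x then v y a else 0) (zeta b t) := by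
  refine ⟨words_zeta b t, fun x hx => ?_⟩
  rw [get_zeta t hx, lowerSum, pack_sum, h.1]
  refine Finset.sum_congr rfl fun y hy => ?_
  rw [pack_ite, h.2 y hy]

theorem IsTable.zipLand_belowTable (h : IsTable b R v t)
    (hv : ∀ x ∈ words b, ∀ a ∈ R, v x a < laneBase) :
    IsTable b R (fun x a => if digits 0 a.1 ≤ x then v x a else 0)
      (zipLand t (belowTable R (fun _ => Nat.sub laneBase 1) b)) := by
  refine ⟨(words_zipLand _ _).trans h.1, fun x hx => ?_⟩
  have h' := (isTable_belowTable (b := b) (R := R) (f := fun _ => Nat.sub laneBase 1)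
    fun _ _ => Nat.sub_lt laneBase_pos one_pos).2 x hx
  rw [get_zipLand _ _ (h.1 ▸ hx), h.2 x hx, h']
  have := pack_land_mask (fun a : ℕ × ℕ => decide (digits 0 a.1 ≤ x)) (hv x hx)
  simpa [mask, cond_eq_ite] using this

/-- The number of pairs `g ≤ h` of words with `h ≤ y` and `g ≤ s`. -/
noncomputable def pairCount (b : Trie) (s y : ℕ → Bool) : ℕ :=
  ∑ h ∈ words b, if h ≤ y then ∑ g ∈ words b, if g ≤ h then if g ≤ s then 1 else 0 else 0 else 0

/-- The number of triples `g ≤ h ≤ y` of words with `s ≤ y ≤ t` and `g ≤ s`. -/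
noncomputable def tripleCount (b : Trie) (s t : ℕ → Bool) : ℕ :=
  ∑ y ∈ words b, if y ≤ t then if s ≤ y then pairCount b s y else 0 else 0

/-- The number of words between `s` and `t`. -/
noncomputable def betweenCount (b : Trie) (s t : ℕ → Bool) : ℕ :=
  ∑ z ∈ words b, if z ≤ t then if s ≤ z then 1 else 0 else 0

/-- The number of tuples `(g, h, y, z, t)` of words with `g ≤ h ≤ y ≤ t`, `g ≤ s ≤ y` and
`s ≤ z ≤ t`. -/
noncomputable def tupleCount (b : Trie) (s : ℕ → Bool) : ℕ :=
  ∑ t ∈ words b, tripleCount b s t * betweenCount b s t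

/-- The table of the numbers `pairCount`. -/
noncomputable def pairTable (R : List (ℕ × ℕ)) (b : Trie) : Trie :=
  zeta b (zeta b (aboveTable R (fun _ => 1) b))

/-- The table of the numbers `tripleCount`. -/
noncomputable def tripleTable (R : List (ℕ × ℕ)) (b : Trie) : Trie :=
  zeta b (zipLand (pairTable R b) (belowTable R (fun _ => Nat.sub laneBase 1) b))

/-- The table of the weighted numbers `betweenCount`. -/
noncomputable def betweenTable (R : List (ℕ × ℕ)) (b : Trie) : Trie :=
  zeta b (belowTable R (fun a => a.2) b)

/-- The weighted sum of the numbers `tupleCount`, computed from the tables. -/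
noncomputable def tupleSum (R : List (ℕ × ℕ)) (b : Trie) : ℕ :=
  sumZip (innerCoeff R.length) (tripleTable R b) (betweenTable R.reverse b)

theorem sum_ite_le_card_mul {ι : Type*} {S : Finset ι} {p : ι → Prop} {f : ι → ℕ} {n : ℕ}
    (h : ∀ i ∈ S, f i ≤ n) : (∑ i ∈ S, if p i then f i else 0) ≤ S.card * n := by
  rw [← smul_eq_mul]
  refine Finset.sum_le_card_nsmul _ _ _ fun i hi => ?_
  split_ifs
  exacts [h i hi, Nat.zero_le n]

theorem pairCount_le (b : Trie) (s y : ℕ → Bool) :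
    pairCount b s y ≤ (words b).card * (words b).card := by
  refine sum_ite_le_card_mul fun h _ => ?_
  refine (sum_ite_le_card_mul (n := 1) fun g _ => ?_).trans (mul_one _).le
  split_ifs <;> simp

theorem tripleCount_le (b : Trie) (s t : ℕ → Bool) :
    tripleCount b s t ≤ (words b).card * ((words b).card * (words b).card) := by
  refine sum_ite_le_card_mul fun y _ => ?_
  split_ifs
  exacts [pairCount_le b s y, Nat.zero_le _]

theorem betweenCount_le (b : Trie) (s t : ℕ → Bool) : betweenCount b s t ≤ (words b).card := by
  refine (sum_ite_le_card_mul (n := 1) fun g _ => ?_).trans (mul_one _).le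
  split_ifs <;> simp

theorem isTable_pairTable :
    IsTable b R (fun y a => pairCount b (digits 0 a.1) y) (pairTable R b) :=
  (isTable_aboveTable fun _ _ => Nat.one_lt_two_pow (n := 80) (by decide)).zeta.zeta

theorem isTable_tripleTable (hN : (words b).card ^ 6 < laneBase) :
    IsTable b R (fun t a => tripleCount b (digits 0 a.1) t) (tripleTable R b) := by
  refine (isTable_pairTable.zipLand_belowTable fun x _ a _ => ?_).zeta
  refine (pairCount_le b _ x).trans_lt (lt_of_le_of_lt ?_ hN)
  rw [← sq]
  exact pow_le_pow_right' (Finset.card_pos.2 ⟨x, ‹_›⟩) (by decide)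

theorem isTable_betweenTable (hR : ∀ a ∈ R, a.2 < laneBase) :
    IsTable b R (fun t a => a.2 * betweenCount b (digits 0 a.1) t) (betweenTable R b) := by
  have := (isTable_belowTable (b := b) hR).zeta
  convert this using 3 with t a
  · simp [betweenCount, Finset.mul_sum]
  · rfl

theorem tupleSum_eq (hN : (words b).card ^ 6 < laneBase) (hl : R.length ≤ (words b).card)
    (hw : (R.map fun a => a.2).sum = (words b).card) :
    tupleSum R b = (R.map fun a => a.2 * tupleCount b (digits 0 a.1)).sum := by
  set N := (words b).card with h_N
  have hG := isTable_tripleTable (R := R) hN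
  have hB := isTable_betweenTable (b := b) (R := R.reverse) fun a ha => by
    have h1 : a.2 ≤ (R.map fun a => a.2).sum :=
      List.single_le_sum (by simp) _ (List.mem_map.2 ⟨a, by simpa using ha, rfl⟩)
    exact (h1.trans (hw.le.trans (Nat.le_self_pow (by decide) N))).trans_lt hN
  rw [tupleSum, sumZip_eq, hG.1]
  have key : ∀ x ∈ words b, innerCoeff R.length (get (tripleTable R b) x)
      (get (betweenTable R.reverse b) x) = (R.map fun a => tripleCount b (digits 0 a.1) x *
        (a.2 * betweenCount b (digits 0 a.1) x)).sum := by
    intro x hx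
    rw [hG.2 x hx, hB.2 x hx]
    refine innerCoeff_pack (lt_of_le_of_lt ?_ hN)
    have h1 : (R.map fun a => tripleCount b (digits 0 a.1) x).sum ≤ N * (N * (N * N)) := by
      refine (List.sum_le_card_nsmul _ (N * (N * N)) ?_).trans ?_
      · simp only [List.mem_map]
        rintro _ ⟨a, -, rfl⟩
        exact tripleCount_le b _ x
      · rw [List.length_map, smul_eq_mul]
        gcongr
    have h2 : (R.map fun a => a.2 * betweenCount b (digits 0 a.1) x).sum ≤ N * N := by
      refine (List.sum_le_sum fun a _ => Nat.mul_le_mul_left a.2 (betweenCount_le b _ x)).trans ?_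
      rw [List.sum_map_mul_right, hw]
    calc _ ≤ N * (N * (N * N)) * (N * N) := Nat.mul_le_mul h1 h2
      _ = N ^ 6 := by ring
  rw [Finset.sum_congr rfl key]
  clear hG hB key hl hw
  induction R with
  | nil => simp
  | cons a R ih =>
    simp only [List.map_cons, List.sum_cons, Finset.sum_add_distrib, ih]
    congr 1
    rw [tupleCount, Finset.mul_sum]
    exact Finset.sum_congr rfl fun x _ => by ring

end Trie

namespace Trie

open scoped Classical

/-- The word whose first `k` letters are the binary digits of `c`, continued by `x`. -/
def prefixWord (c k : ℕ) (x : ℕ → Bool) : ℕ → Bool :=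
  fun i => if i < k then c.testBit i else x (i - k)

theorem prefixWord_zero (c : ℕ) (x : ℕ → Bool) : prefixWord c 0 x = x := rfl

theorem prefixWord_bot {c k : ℕ} (hc : c < 2 ^ k) : prefixWord c k ⊥ = digits 0 c := by
  funext i
  by_cases hi : i < k
  · simp [prefixWord, digits, hi]
  · have : c.testBit i = false :=
      Nat.testBit_lt_two_pow (hc.trans_le (Nat.pow_le_pow_right two_pos (not_lt.1 hi)))
    simp [prefixWord, digits, hi, this]

theorem prefixWord_consWord_false {c k : ℕ} (hc : c < 2 ^ k) (x : ℕ → Bool) :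
    prefixWord c k (consWord false x) = prefixWord c (k + 1) x := by
  funext i
  rcases lt_trichotomy i k with hi | rfl | hi
  · simp [prefixWord, hi, hi.trans (Nat.lt_succ_self k)]
  · simp [prefixWord, consWord, Nat.testBit_lt_two_pow hc]
  · obtain ⟨j, rfl⟩ := Nat.exists_eq_add_of_lt hi
    simp [prefixWord, consWord, show k + j + 1 - k = j + 1 by omega,
      show k + j + 1 - (k + 1) = j by omega, show ¬k + j + 1 < k by omega]

theorem prefixWord_consWord_true {c k : ℕ} (hc : c < 2 ^ k) (x : ℕ → Bool) :
    prefixWord c k (consWord true x) = prefixWord (c + 2 ^ k) (k + 1) x := by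
  funext i
  rcases lt_trichotomy i k with hi | rfl | hi
  · simp [prefixWord, hi, hi.trans (Nat.lt_succ_self k), add_comm c,
      Nat.testBit_two_pow_add_gt hi]
  · simp [prefixWord, consWord, add_comm c, Nat.testBit_two_pow_add_eq,
      Nat.testBit_lt_two_pow hc]
  · obtain ⟨j, rfl⟩ := Nat.exists_eq_add_of_lt hi
    simp [prefixWord, consWord, show k + j + 1 - k = j + 1 by omega,
      show k + j + 1 - (k + 1) = j by omega, show ¬k + j + 1 < k by omega]

theorem add_two_pow_lt {c k : ℕ} (hc : c < 2 ^ k) : c + 2 ^ k < 2 ^ (k + 1) := by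
  rw [pow_succ]
  omega

theorem mem_words_build {u : ℕ → ℕ} (hu : ∀ k i, (u k).testBit i = true → i < k) (n : ℕ) {k p : ℕ}
    (hp : p < 2 ^ k) (x : ℕ → Bool) :
    x ∈ words (build u n k p) ↔ (∀ j, n ≤ j → x j = false) ∧
      ∀ j < n, x j = true → ∀ i, (u (k + j)).testBit i = true → prefixWord p k x i = true := by
  induction n generalizing k p x with
  | zero =>
    change x ∈ words (leaf 0) ↔ _
    simp [funext_iff]
  | succ n ih =>
    have hcond : Nat.beq (Nat.land p (u k)) (u k) = true ↔
        ∀ i, (u k).testBit i = true → p.testBit i = true := by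
      rw [Nat.beq_eq]
      change p &&& u k = u k ↔ _
      constructor
      · intro h i hi
        rw [← h, Nat.testBit_and, Bool.and_eq_true] at hi
        exact hi.1
      · intro h
        refine Nat.eq_of_testBit_eq fun i => ?_
        rw [Nat.testBit_and]
        cases hi : (u k).testBit i
        · simp
        · simp [h i hi]
    change x ∈ words (mkNode (build u n (k + 1) p)
      (Bool.rec nil (build u n (k + 1) (p + 2 ^ k)) (Nat.beq (Nat.land p (u k)) (u k)))) ↔ _
    rw [words_mkNode]
    obtain ⟨_ | _, y, rfl⟩ := consWord_surjective x
    · rw [consWord_false_mem_words, ih (hp.trans (Nat.pow_lt_pow_succ one_lt_two)),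
        prefixWord_consWord_false hp]
      constructor
      · rintro ⟨h, h'⟩
        refine ⟨fun j hj => ?_, fun j hj hx i hi => ?_⟩
        · obtain ⟨j, rfl⟩ := Nat.exists_eq_add_of_lt (Nat.lt_of_succ_le hj)
          exact h _ (Nat.le_add_right n j)
        · cases j with
          | zero => cases hx
          | succ j => exact h' j (by omega) hx i (by rwa [add_assoc, add_comm 1])
      · rintro ⟨h, h'⟩
        refine ⟨fun j hj => h (j + 1) (by omega), fun j hj hx i hi => ?_⟩
        exact h' (j + 1) (by omega) hx i (by rwa [add_assoc, add_comm 1] at hi)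
    · rw [consWord_true_mem_words, prefixWord_consWord_true hp]
      cases hc : Nat.beq (Nat.land p (u k)) (u k)
      · refine iff_of_false (by simp) fun h => ?_
        rw [← Bool.not_eq_true, hcond] at hc
        refine hc fun i hi => ?_
        have := h.2 0 (by omega) rfl i hi
        rwa [prefixWord, if_pos ((hu k i hi).trans (Nat.lt_succ_self k)), add_comm,
          Nat.testBit_two_pow_add_gt (hu k i hi)] at this
      · rw [hcond] at hc
        rw [ih (add_two_pow_lt hp)]
        constructor
        · rintro ⟨h, h'⟩
          refine ⟨fun j hj => ?_, fun j hj hx i hi => ?_⟩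
          · obtain ⟨j, rfl⟩ := Nat.exists_eq_add_of_lt (Nat.lt_of_succ_le hj)
            exact h _ (Nat.le_add_right n j)
          · cases j with
            | zero =>
              rw [prefixWord, if_pos ((hu k i hi).trans (Nat.lt_succ_self k)), add_comm,
                Nat.testBit_two_pow_add_gt (hu k i hi)]
              exact hc i hi
            | succ j => exact h' j (by omega) hx i (by rwa [add_assoc, add_comm 1])
        · rintro ⟨h, h'⟩
          refine ⟨fun j hj => h (j + 1) (by omega), fun j hj hx i hi => ?_⟩
          exact h' (j + 1) (by omega) hx i (by rwa [add_assoc, add_comm 1] at hi)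

/-- The sum of the values of a trie, weighted by the function `φ` of the words, which are read as
binary numbers. -/
def weightedSum (φ : ℕ → ℕ) : Trie → ℕ → ℕ → ℕ
  | nil, _, _ => 0
  | leaf v, _, c => v * φ c
  | node l r, k, c => weightedSum φ l (k + 1) c + weightedSum φ r (k + 1) (c + 2 ^ k)

variable (φ : ℕ → ℕ)

theorem weightedSum_addZero (a : ℕ) (t : Trie) (k c : ℕ) :
    weightedSum φ (addZero a t) k c = a * φ c + weightedSum φ t k c := by
  induction t generalizing k c with
  | nil => rfl
  | leaf v => exact add_mul a v (φ c)
  | node l r hl hr =>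
    change weightedSum φ (addZero a l) (k + 1) c + weightedSum φ r (k + 1) (c + 2 ^ k) = _
    rw [hl, weightedSum, add_assoc]

theorem weightedSum_add (s t : Trie) (k c : ℕ) :
    weightedSum φ (add s t) k c = weightedSum φ s k c + weightedSum φ t k c := by
  induction s generalizing t k c with
  | nil => exact (zero_add _).symm
  | leaf v => exact weightedSum_addZero φ v t k c
  | node l r hl hr =>
    cases t with
    | nil => rfl
    | leaf v =>
      change weightedSum φ (addZero v l) (k + 1) c + weightedSum φ r (k + 1) (c + 2 ^ k) = _
      rw [weightedSum_addZero, weightedSum, weightedSum]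
      ring
    | node l' r' =>
      change weightedSum φ (add l l') (k + 1) c + weightedSum φ (add r r') (k + 1) (c + 2 ^ k) = _
      rw [hl, hr, weightedSum, weightedSum]
      ring

theorem weightedSum_single {n d : ℕ} (hd : d < 2 ^ n) (k c : ℕ) :
    weightedSum φ (single n d) k c = φ (c + 2 ^ k * d) := by
  induction n generalizing d k c with
  | zero =>
    obtain rfl : d = 0 := by simpa using hd
    exact (one_mul _)
  | succ n ih =>
    change weightedSum φ (Bool.rec (Bool.rec (node (single n (d / 2)) nil)
      (node nil (single n (d / 2))) (Nat.beq (d % 2) 1)) (leaf 1) (Nat.beq d 0)) k c = _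
    have hd' : d / 2 < 2 ^ n := by rw [pow_succ] at hd; omega
    have h2 := Nat.div_add_mod d 2
    cases h0 : Nat.beq d 0
    · cases h1 : Nat.beq (d % 2) 1
      · have h1' : d % 2 ≠ 1 := fun h => by simp [h] at h1
        rw [show d % 2 = 0 by omega, add_zero] at h2
        change weightedSum φ (single n (d / 2)) (k + 1) c + 0 = _
        rw [ih hd', add_zero, ← congrArg (fun d => φ (c + 2 ^ k * d)) h2, pow_succ, mul_assoc]
      · rw [Nat.eq_of_beq_eq_true h1] at h2
        change 0 + weightedSum φ (single n (d / 2)) (k + 1) (c + 2 ^ k) = _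
        rw [ih hd', zero_add, ← congrArg (fun d => φ (c + 2 ^ k * d)) h2]
        congr 1
        ring
    · rw [Nat.eq_of_beq_eq_true h0]
      exact one_mul _

theorem sum_map_toList (t : Trie) (k c : ℕ) (acc : List (ℕ × ℕ)) :
    ((toList t k c acc).map fun a => a.2 * φ a.1).sum =
      weightedSum φ t k c + (acc.map fun a => a.2 * φ a.1).sum := by
  induction t generalizing k c acc with
  | nil => exact (zero_add _).symm
  | leaf v => rfl
  | node l r hl hr =>
    change ((toList l (k + 1) c (toList r (k + 1) (c + 2 ^ k) acc)).map _).sum = _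
    rw [hl, hr, weightedSum, add_assoc]

theorem weightedSum_pushforward {f : ℕ → ℕ} {ψ : (ℕ → Bool) → ℕ}
    (hf : ∀ c < 2 ^ 32, f c < 2 ^ 32 ∧ φ (f c) = ψ (digits 0 c)) (b : Trie) {k c : ℕ}
    (hc : c < 2 ^ k) (hb : ∀ x ∈ words b, ∀ j, 32 ≤ j → prefixWord c k x j = false) :
    weightedSum φ (pushforward f b k c) 0 0 = ∑ x ∈ words b, ψ (prefixWord c k x) := by
  induction b generalizing k c with
  | nil => rfl
  | leaf v =>
    simp only [words_leaf, Finset.mem_singleton, forall_eq, Finset.sum_singleton,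
      prefixWord_bot hc] at hb ⊢
    have hc' : c < 2 ^ 32 := Nat.lt_pow_two_of_testBit c fun j hj => by
      simpa [digits] using hb j hj
    change weightedSum φ (single 32 (f c)) 0 0 = _
    rw [weightedSum_single φ (hf c hc').1, pow_zero, one_mul, zero_add, (hf c hc').2]
  | node l r hl hr =>
    change weightedSum φ (add (pushforward f l (k + 1) c)
      (pushforward f r (k + 1) (c + 2 ^ k))) 0 0 = _
    rw [weightedSum_add, sum_words_node, hl (hc.trans (Nat.pow_lt_pow_succ one_lt_two)),
      hr (add_two_pow_lt hc)]
    · simp only [prefixWord_consWord_false hc, prefixWord_consWord_true hc]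
    · intro x hx
      rw [← prefixWord_consWord_true hc]
      exact hb _ (by simpa using hx)
    · intro x hx
      rw [← prefixWord_consWord_false hc]
      exact hb _ (by simpa using hx)

theorem tupleCount_orderIso (b : Trie) (e : (ℕ → Bool) ≃o (ℕ → Bool))
    (he : ∀ x, e x ∈ words b ↔ x ∈ words b) (s : ℕ → Bool) :
    tupleCount b (e s) = tupleCount b s := by
  have hsum (f : (ℕ → Bool) → ℕ) : ∑ x ∈ words b, f x = ∑ x ∈ words b, f (e x) :=
    (Finset.sum_equiv e.toEquiv (fun x => (he x).symm) fun _ _ => rfl).symm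
  have hpair (y : ℕ → Bool) : pairCount b (e s) (e y) = pairCount b s y := by
    simp only [pairCount]
    rw [hsum]
    refine Finset.sum_congr rfl fun h _ => ?_
    rw [hsum]
    simp only [e.le_iff_le]
  have htriple (t : ℕ → Bool) : tripleCount b (e s) (e t) = tripleCount b s t := by
    simp only [tripleCount]
    rw [hsum]
    simp only [e.le_iff_le, hpair]
  have hbetween (t : ℕ → Bool) : betweenCount b (e s) (e t) = betweenCount b s t := by
    simp only [betweenCount]
    rw [hsum]
    simp only [e.le_iff_le]
  rw [tupleCount, hsum]
  simp only [htriple, hbetween]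
  rfl

end Trie

namespace Trie

/-- The bit mask of the `i < k` whose binary digits are among those of `k`. -/
noncomputable def upmask (k : ℕ) : ℕ :=
  Nat.rec 0 (fun j s => Bool.rec s (Nat.add s (Nat.pow 2 j)) (Nat.beq (Nat.land j k) j)) k

/-- The trie of the monotone Boolean functions of five variables. The value at a point `x` is the
letter at the position whose binary digits are the complements of those of `x`. -/
@[irreducible] noncomputable def base : Trie := build upmask 32 0 0

/-- Swaps the blocks of binary digits of `y` selected by `a` with those lying `d` positions higher,
keeping the digits selected by `m`. -/
noncomputable def deltaSwap (m a d y : ℕ) : ℕ :=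
  Nat.lor (Nat.land y m)
    (Nat.lor (Nat.shiftLeft (Nat.land y a) d) (Nat.land (Nat.shiftRight y d) a))

/-- The smaller of `y` and `deltaSwap m a d y`. -/
noncomputable def minSwap (m a d y : ℕ) : ℕ :=
  Bool.rec y (deltaSwap m a d y) (Nat.ble (deltaSwap m a d y) y)

/-- Minimization over the transposition of the variables `0` and `1`. -/
noncomputable def minSwap₀ : ℕ → ℕ := minSwap 0x99999999 0x22222222 1

/-- Minimization over the transposition of the variables `1` and `2`. -/
noncomputable def minSwap₁ : ℕ → ℕ := minSwap 0xC3C3C3C3 0x0C0C0C0C 2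

/-- Minimization over the transposition of the variables `2` and `3`. -/
noncomputable def minSwap₂ : ℕ → ℕ := minSwap 0xF00FF00F 0x00F000F0 4

/-- Minimization over the transposition of the variables `3` and `4`. -/
noncomputable def minSwap₃ : ℕ → ℕ := minSwap 0xFF0000FF 0x0000FF00 8

/-- A representative of `y` up to permutations of the variables; equivalent functions need not have
the same representative. -/
noncomputable def representative (y : ℕ) : ℕ :=
  minSwap₀ (minSwap₁ (minSwap₀ (minSwap₂ (minSwap₁ (minSwap₀
    (minSwap₃ (minSwap₂ (minSwap₁ (minSwap₀ y)))))))))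

/-- The representatives of the words of `base`, with their multiplicities. -/
@[irreducible] noncomputable def reps : List (ℕ × ℕ) :=
  toList (pushforward representative base 0 0) 0 0 []

theorem testBit_upmask (k i : ℕ) : (upmask k).testBit i = true ↔ i < k ∧ i &&& k = i := by
  let aux (n : ℕ) : ℕ :=
    Nat.rec 0 (fun j s => Bool.rec s (Nat.add s (Nat.pow 2 j)) (Nat.beq (Nat.land j k) j)) n
  suffices h : ∀ n, aux n < 2 ^ n ∧ ((aux n).testBit i = true ↔ i < n ∧ i &&& k = i) from (h k).2
  intro n
  induction n with
  | zero => exact ⟨one_pos, by simp [aux]⟩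
  | succ n ih =>
    have hs : aux (n + 1) =
      Bool.rec (aux n) (aux n + 2 ^ n) (Nat.beq (Nat.land n k) n) := rfl
    rw [hs]
    cases h : Nat.beq (Nat.land n k) n
    · have h' : n &&& k ≠ n := fun h' => by
        rw [← Bool.not_eq_true, Nat.beq_eq] at h
        exact h h'
      refine ⟨ih.1.trans (Nat.pow_lt_pow_succ one_lt_two), ih.2.trans ?_⟩
      constructor
      · exact fun hi => ⟨hi.1.trans (Nat.lt_succ_self n), hi.2⟩
      · rintro ⟨hi, hi'⟩
        refine ⟨lt_of_le_of_ne (Nat.le_of_lt_succ hi) ?_, hi'⟩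
        rintro rfl
        exact h' hi'
    · have h' : n &&& k = n := Nat.eq_of_beq_eq_true h
      refine ⟨add_two_pow_lt ih.1, ?_⟩
      change (aux n + 2 ^ n).testBit i = true ↔ _
      rw [add_comm]
      rcases lt_trichotomy i n with hi | rfl | hi
      · rw [Nat.testBit_two_pow_add_gt hi, ih.2]
        simp [hi, hi.trans (Nat.lt_succ_self n)]
      · rw [Nat.testBit_two_pow_add_eq, Nat.testBit_lt_two_pow ih.1]
        simp [h']
      · have : (2 ^ n + aux n).testBit i = false := by
          refine Nat.testBit_lt_two_pow (lt_of_lt_of_le ?_ (Nat.pow_le_pow_right two_pos hi))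
          rw [add_comm]
          exact add_two_pow_lt ih.1
        simp [this, show ¬i < n + 1 by omega]

theorem mem_words_base (x : ℕ → Bool) : x ∈ words base ↔
    (∀ j, 32 ≤ j → x j = false) ∧ ∀ i j, i &&& j = i → x j = true → x i = true := by
  rw [base, mem_words_build (fun k i h => ((testBit_upmask k i).1 h).1) 32 one_pos]
  simp only [zero_add, testBit_upmask, prefixWord_zero]
  refine and_congr_right fun h => ⟨fun h' i j hij hj => ?_, fun h' j _ hj i hi => h' i j hi.2 hj⟩
  rcases (hij ▸ Nat.and_le_right : i ≤ j).eq_or_lt with rfl | hlt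
  · exact hj
  · refine h' j (not_le.1 fun hj' => ?_) hj i ⟨hlt, hij⟩
    simp [h j hj'] at hj

/-- Exchanges the binary digits `e` and `e + 1` of a number below `32`. -/
def bitSwap (e k : ℕ) : ℕ :=
  if k < 32 ∧ k.testBit e ≠ k.testBit (e + 1) then k ^^^ (3 * 2 ^ e) else k

theorem bitSwap_of_le (e : ℕ) {k : ℕ} (hk : 32 ≤ k) : bitSwap e k = k :=
  if_neg fun h => absurd h.1 (not_lt.2 hk)

theorem bitSwap_spec {e : ℕ} (he : e < 4) {k : ℕ} (hk : k < 32) : bitSwap e k < 32 ∧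
    bitSwap e (bitSwap e k) = k ∧
      ∀ i < 32, i &&& k = i → bitSwap e i &&& bitSwap e k = bitSwap e i := by
  have : ∀ e < 4, ∀ k < 32, bitSwap e k < 32 ∧ bitSwap e (bitSwap e k) = k ∧
      ∀ i < 32, i &&& k = i → bitSwap e i &&& bitSwap e k = bitSwap e i := by
    decide +kernel
  exact this e he k hk

theorem bitSwap_involutive {e : ℕ} (he : e < 4) : Function.Involutive (bitSwap e) := fun k => by
  rcases lt_or_ge k 32 with hk | hk
  · exact (bitSwap_spec he hk).2.1
  · rw [bitSwap_of_le e hk, bitSwap_of_le e hk]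

theorem comp_bitSwap_mem_words_base {e : ℕ} (he : e < 4) {x : ℕ → Bool} (hx : x ∈ words base) :
    x ∘ bitSwap e ∈ words base := by
  rw [mem_words_base] at hx ⊢
  refine ⟨fun j hj => ?_, fun i j hij hj => ?_⟩
  · simpa [bitSwap_of_le e hj] using hx.1 j hj
  · rcases lt_or_ge j 32 with hj' | hj'
    · have hi : i < 32 := (hij ▸ Nat.and_le_right : i ≤ j).trans_lt hj'
      exact hx.2 _ _ ((bitSwap_spec he hj').2.2 i hi hij) hj
    · rw [Function.comp_apply, bitSwap_of_le e hj', hx.1 j hj'] at hj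
      cases hj

/-- The action of `bitSwap e` on words. -/
def bitSwapIso {e : ℕ} (he : e < 4) : (ℕ → Bool) ≃o (ℕ → Bool) where
  toFun x := x ∘ bitSwap e
  invFun x := x ∘ bitSwap e
  left_inv x := funext fun k => congrArg x (bitSwap_involutive he k)
  right_inv x := funext fun k => congrArg x (bitSwap_involutive he k)
  map_rel_iff' := by
    intro x y
    refine ⟨fun h k => ?_, fun h k => h _⟩
    have := h (bitSwap e k)
    simpa [bitSwap_involutive he k] using this

theorem tupleCount_comp_bitSwap {e : ℕ} (he : e < 4) (s : ℕ → Bool) :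
    tupleCount base (s ∘ bitSwap e) = tupleCount base s := by
  refine tupleCount_orderIso base (bitSwapIso he) (fun x => ?_) s
  refine ⟨fun h => ?_, comp_bitSwap_mem_words_base he⟩
  have := comp_bitSwap_mem_words_base he h
  rwa [← (bitSwapIso he).left_inv x]

theorem testBit_deltaSwap (m a d y k : ℕ) : (deltaSwap m a d y).testBit k =
    (y.testBit k && m.testBit k || (decide (d ≤ k) && (y.testBit (k - d) && a.testBit (k - d)) ||
      y.testBit (d + k) && a.testBit k)) := by
  change (y &&& m ||| ((y &&& a) <<< d ||| (y >>> d) &&& a)).testBit k = _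
  simp [Nat.testBit_or, Nat.testBit_and, Nat.testBit_shiftLeft, Nat.testBit_shiftRight]

/-- The masks `m` and `a` describe the exchange of the index bits `e` and `e + 1`. -/
def IsSwapMask (m a d e : ℕ) : Prop :=
  a * 2 ^ d < 2 ^ 32 ∧ ∀ k < 32,
    m.testBit k = true ∧ (decide (d ≤ k) && a.testBit (k - d)) = false ∧ a.testBit k = false ∧
      bitSwap e k = k ∨
    m.testBit k = false ∧ (decide (d ≤ k) && a.testBit (k - d)) = true ∧ a.testBit k = false ∧
      bitSwap e k = k - d ∨
    m.testBit k = false ∧ (decide (d ≤ k) && a.testBit (k - d)) = false ∧ a.testBit k = true ∧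
      bitSwap e k = d + k

instance (m a d e : ℕ) : Decidable (IsSwapMask m a d e) :=
  instDecidableAnd

variable {m a d e y : ℕ}

theorem IsSwapMask.digits_deltaSwap (h : IsSwapMask m a d e) (hy : y < 2 ^ 32) :
    digits 0 (deltaSwap m a d y) = digits 0 y ∘ bitSwap e := by
  have hy' {k : ℕ} (hk : 32 ≤ k) : y.testBit k = false :=
    Nat.testBit_lt_two_pow (hy.trans_le (Nat.pow_le_pow_right two_pos hk))
  funext k
  simp only [digits, zero_add, Function.comp_apply]
  rw [testBit_deltaSwap]
  rcases lt_or_ge k 32 with hk | hk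
  · rcases h.2 k hk with ⟨h1, h2, h3, h4⟩ | ⟨h1, h2, h3, h4⟩ | ⟨h1, h2, h3, h4⟩ <;>
      rw [h4, h1, h3, Bool.and_left_comm, h2] <;> simp
  · have ha : (decide (d ≤ k) && a.testBit (k - d)) = false := by
      have := Nat.testBit_lt_two_pow (h.1.trans_le (Nat.pow_le_pow_right two_pos hk))
      rwa [mul_comm, Nat.testBit_two_pow_mul] at this
    rw [Bool.and_left_comm, ha, bitSwap_of_le e hk, hy' hk, hy' (hk.trans (Nat.le_add_left k d))]
    simp

theorem lt_of_digits_eq {c : ℕ} {x : ℕ → Bool} (h : digits 0 c = x)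
    (hx : ∀ j, 32 ≤ j → x j = false) : c < 2 ^ 32 :=
  Nat.lt_pow_two_of_testBit c fun j hj => by
    have := congrFun h j
    rw [digits, zero_add] at this
    rw [this, hx j hj]

/-- The function `f` preserves the numbers below `2 ^ 32` and their `tupleCount`. -/
def PreservesTupleCount (f : ℕ → ℕ) : Prop :=
  ∀ c < 2 ^ 32, f c < 2 ^ 32 ∧ tupleCount base (digits 0 (f c)) = tupleCount base (digits 0 c)

theorem PreservesTupleCount.comp {f g : ℕ → ℕ} (hf : PreservesTupleCount f)
    (hg : PreservesTupleCount g) : PreservesTupleCount fun c => f (g c) := fun c hc =>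
  ⟨(hf _ (hg c hc).1).1, (hf _ (hg c hc).1).2.trans (hg c hc).2⟩

theorem IsSwapMask.preservesTupleCount (h : IsSwapMask m a d e) (he : e < 4) :
    PreservesTupleCount (minSwap m a d) := by
  intro c hc
  rw [minSwap]
  cases Nat.ble (deltaSwap m a d c) c
  · exact ⟨hc, rfl⟩
  · have hd := h.digits_deltaSwap hc
    refine ⟨lt_of_digits_eq hd fun j hj => ?_, ?_⟩
    · rw [Function.comp_apply, bitSwap_of_le e hj, digits, zero_add]
      exact Nat.testBit_lt_two_pow (hc.trans_le (Nat.pow_le_pow_right two_pos hj))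
    · change tupleCount base (digits 0 (deltaSwap m a d c)) = _
      rw [hd, tupleCount_comp_bitSwap he]

theorem preservesTupleCount_representative : PreservesTupleCount representative := by
  have h0 : PreservesTupleCount minSwap₀ :=
    IsSwapMask.preservesTupleCount (e := 0) (by decide +kernel) (by decide)
  have h1 : PreservesTupleCount minSwap₁ :=
    IsSwapMask.preservesTupleCount (e := 1) (by decide +kernel) (by decide)
  have h2 : PreservesTupleCount minSwap₂ :=
    IsSwapMask.preservesTupleCount (e := 2) (by decide +kernel) (by decide)
  have h3 : PreservesTupleCount minSwap₃ :=
    IsSwapMask.preservesTupleCount (e := 3) (by decide +kernel) (by decide)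
  exact h0.comp <| h1.comp <| h0.comp <| h2.comp <| h1.comp <| h0.comp <| h3.comp <| h2.comp <|
    h1.comp h0

theorem sum_map_reps {φ : ℕ → ℕ} {ψ : (ℕ → Bool) → ℕ}
    (h : ∀ c < 2 ^ 32, φ (representative c) = ψ (digits 0 c)) :
    (reps.map fun a => a.2 * φ a.1).sum = ∑ x ∈ words base, ψ x := by
  rw [reps, sum_map_toList, List.map_nil, List.sum_nil, add_zero, weightedSum_pushforward (ψ := ψ)]
  · simp only [prefixWord_zero]
  · exact fun c hc => ⟨(preservesTupleCount_representative c hc).1, h c hc⟩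
  · exact one_pos
  · exact fun x hx => ((mem_words_base x).1 hx).1

theorem sum_map_snd_reps : (reps.map fun a => a.2).sum = (words base).card := by
  have := sum_map_reps (φ := fun _ => 1) (ψ := fun _ => 1) fun _ _ => rfl
  simpa using this

theorem sum_map_mul_tupleCount_reps : (reps.map fun a => a.2 * tupleCount base (digits 0 a.1)).sum =
    ∑ s ∈ words base, tupleCount base s :=
  sum_map_reps (φ := fun c => tupleCount base (digits 0 c))
    fun c hc => (preservesTupleCount_representative c hc).2

theorem reps_spec : (Nat.beq (reps.map fun a => a.2).sum 7581 &&
    (Nat.ble reps.length 7581 && Nat.beq (tupleSum reps base) 101627867809333596)) = true := by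
  decide +kernel

theorem sum_tupleCount_base : ∑ s ∈ words base, tupleCount base s = 101627867809333596 := by
  have h := reps_spec
  rw [Bool.and_eq_true, Bool.and_eq_true, Nat.beq_eq, Nat.beq_eq, Nat.ble_eq] at h
  obtain ⟨hw, hl, h⟩ := h
  have hN : (words base).card = 7581 := sum_map_snd_reps.symm.trans hw
  have hX : 7581 ^ 6 < laneBase := by
    change _ < 2 ^ 80
    norm_num
  rw [← sum_map_mul_tupleCount_reps, ← tupleSum_eq (hN ▸ hX) (hN ▸ hl) sum_map_snd_reps, h]

end Trie

section Slices

/-- The point of the cube with first coordinates `a`, `b`, `c`, whose other coordinates are the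
complements of the binary digits of `k`. -/
def cubePoint (a b c : Bool) (k : ℕ) : Fin 8 → Bool :=
  Fin.cons a (Fin.cons b (Fin.cons c fun i : Fin 5 => !k.testBit i))

/-- The number whose binary digits are the complements of the last coordinates of `v`. -/
def cubeIndex (v : Fin 8 → Bool) : ℕ := Nat.ofBits fun i : Fin 5 => !v (Fin.natAdd 3 i)

theorem cubeIndex_lt (v : Fin 8 → Bool) : cubeIndex v < 32 := Nat.ofBits_lt_two_pow _

theorem testBit_cubeIndex (v : Fin 8 → Bool) (i : Fin 5) :
    (cubeIndex v).testBit i = !v (Fin.natAdd 3 i) := Nat.testBit_ofBits_lt _ _ i.2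

theorem testBit_eq_false_of_lt {k : ℕ} (hk : k < 32) {i : ℕ} (hi : 5 ≤ i) : k.testBit i = false :=
  Nat.testBit_lt_two_pow (hk.trans_le (Nat.pow_le_pow_right two_pos hi))

theorem cubePoint_cubeIndex (v : Fin 8 → Bool) :
    cubePoint (v 0) (v 1) (v 2) (cubeIndex v) = v := by
  have h (i : Fin 5) : (!(cubeIndex v).testBit i) = v (Fin.natAdd 3 i) := by
    rw [testBit_cubeIndex, Bool.not_not]
  funext i
  fin_cases i
  exacts [rfl, rfl, rfl, h 0, h 1, h 2, h 3, h 4]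

theorem cubeIndex_cubePoint (a b c : Bool) {k : ℕ} (hk : k < 32) :
    cubeIndex (cubePoint a b c k) = k := by
  refine Nat.eq_of_testBit_eq fun i => ?_
  rcases lt_or_ge i 5 with hi | hi
  · refine (testBit_cubeIndex _ ⟨i, hi⟩).trans ?_
    interval_cases i <;> exact Bool.not_not _
  · rw [testBit_eq_false_of_lt (cubeIndex_lt _) hi, testBit_eq_false_of_lt hk hi]

theorem cubePoint_comp_swap (a b c : Bool) (k : ℕ) :
    cubePoint a b c k ∘ (Equiv.swap 0 1 : Equiv.Perm (Fin 8)) = cubePoint b a c k := by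
  funext i
  fin_cases i <;> rfl

theorem cubePoint_le {a b c a' b' c' : Bool} (ha : a ≤ a') (hb : b ≤ b') (hc : c ≤ c') {i j : ℕ}
    (h : i &&& j = i) : cubePoint a b c j ≤ cubePoint a' b' c' i := by
  have h' (l : ℕ) : (!j.testBit l) ≤ (!i.testBit l) := by
    rw [← h, Nat.testBit_and]
    cases i.testBit l <;> cases j.testBit l <;> decide
  intro l
  fin_cases l
  exacts [ha, hb, hc, h' 0, h' 1, h' 2, h' 3, h' 4]

theorem cubeIndex_land {v v' : Fin 8 → Bool} (h : v ≤ v') :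
    cubeIndex v' &&& cubeIndex v = cubeIndex v' := by
  refine Nat.eq_of_testBit_eq fun i => ?_
  rw [Nat.testBit_and]
  rcases lt_or_ge i 5 with hi | hi
  · have h1 := testBit_cubeIndex v ⟨i, hi⟩
    have h2 := testBit_cubeIndex v' ⟨i, hi⟩
    have h3 : v (Fin.natAdd 3 ⟨i, hi⟩) ≤ v' (Fin.natAdd 3 ⟨i, hi⟩) := h _
    simp only at h1 h2
    rw [h1, h2]
    revert h3
    generalize v (Fin.natAdd 3 ⟨i, hi⟩) = p, v' (Fin.natAdd 3 ⟨i, hi⟩) = q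
    revert p q
    decide
  · rw [testBit_eq_false_of_lt (cubeIndex_lt _) hi, Bool.false_and]

/-- The restriction of a Boolean function to the points with first coordinates `a`, `b`, `c`, as a
word. -/
def sliceWord (f : (Fin 8 → Bool) → Bool) (a b c : Bool) : ℕ → Bool :=
  fun k => decide (k < 32) && f (cubePoint a b c k)

variable {f : (Fin 8 → Bool) → Bool}

theorem sliceWord_cubeIndex (f : (Fin 8 → Bool) → Bool) (v : Fin 8 → Bool) :
    sliceWord f (v 0) (v 1) (v 2) (cubeIndex v) = f v := by
  simp [sliceWord, cubeIndex_lt, cubePoint_cubeIndex]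

theorem sliceWord_mono (hf : Monotone f) {a b c a' b' c' : Bool} (ha : a ≤ a') (hb : b ≤ b')
    (hc : c ≤ c') : sliceWord f a b c ≤ sliceWord f a' b' c' := by
  intro k
  have := hf (cubePoint_le ha hb hc (Nat.and_self k))
  simp only [sliceWord]
  cases decide (k < 32)
  exacts [le_rfl, this]

theorem sliceWord_mem_words (hf : Monotone f) (a b c : Bool) :
    sliceWord f a b c ∈ Trie.words Trie.base := by
  rw [Trie.mem_words_base]
  refine ⟨fun j hj => by simp [sliceWord, not_lt.2 hj], fun i j hij h => ?_⟩
  simp only [sliceWord, Bool.and_eq_true, decide_eq_true_eq] at h ⊢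
  have hi : i ≤ j := hij ▸ Nat.and_le_right
  refine ⟨hi.trans_lt h.1, ?_⟩
  exact hf (cubePoint_le le_rfl le_rfl le_rfl hij) h.2

/-- The tuples `(s, t, y, h, g, z)` counted by `Trie.tupleCount` for some `s`. -/
noncomputable def sliceTuples (b : Trie) :
    Finset ((ℕ → Bool) × (ℕ → Bool) × (ℕ → Bool) × (ℕ → Bool) × (ℕ → Bool) × (ℕ → Bool)) :=
  open scoped Classical in
  {p ∈ b.words ×ˢ b.words ×ˢ b.words ×ˢ b.words ×ˢ b.words ×ˢ b.words |
    match p with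
    | (s, t, y, h, g, z) => y ≤ t ∧ s ≤ y ∧ h ≤ y ∧ g ≤ h ∧ g ≤ s ∧ z ≤ t ∧ s ≤ z}

theorem card_sliceTuples (b : Trie) : (sliceTuples b).card = ∑ s ∈ b.words, b.tupleCount s := by
  rw [sliceTuples, Finset.card_filter]
  simp only [Finset.sum_product, Trie.tupleCount, Trie.tripleCount]
  refine Finset.sum_congr rfl fun s _ => Finset.sum_congr rfl fun t _ => ?_
  rw [Finset.sum_mul]
  refine Finset.sum_congr rfl fun y _ => ?_
  by_cases hy : y ≤ t ∧ s ≤ y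
  swap
  · rw [← ite_and, if_neg hy, zero_mul]
    exact Finset.sum_eq_zero fun h _ => Finset.sum_eq_zero fun g _ => Finset.sum_eq_zero fun z _ =>
      if_neg fun h => hy ⟨h.1, h.2.1⟩
  rw [if_pos hy.1, if_pos hy.2, Trie.pairCount, Finset.sum_mul]
  refine Finset.sum_congr rfl fun h _ => ?_
  by_cases hh : h ≤ y
  swap
  · rw [if_neg hh, zero_mul]
    exact Finset.sum_eq_zero fun g _ => Finset.sum_eq_zero fun z _ => if_neg fun h => hh h.2.2.1
  rw [if_pos hh, Finset.sum_mul]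
  refine Finset.sum_congr rfl fun g _ => ?_
  by_cases hg : g ≤ h ∧ g ≤ s
  swap
  · rw [← ite_and, if_neg hg, zero_mul]
    exact Finset.sum_eq_zero fun z _ => if_neg fun h => hg ⟨h.2.2.2.1, h.2.2.2.2.1⟩
  rw [if_pos hg.1, if_pos hg.2, one_mul, Trie.betweenCount]
  refine Finset.sum_congr rfl fun z _ => ?_
  rw [← ite_and]
  classical exact if_congr (by tauto) rfl rfl

/-- The family of slices of a Boolean function invariant under the exchange of the first two
coordinates, in terms of its values at `(0, 0, 0)`, `(0, 0, 1)`, `(0, 1, 0)`, `(0, 1, 1)`,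
`(1, 1, 0)` and `(1, 1, 1)`. -/
def sliceFamily {α : Type*} (g h s y z t : α) : Bool → Bool → Bool → α
  | false, false, false => g
  | false, false, true => h
  | false, true, false => s
  | false, true, true => y
  | true, false, false => s
  | true, false, true => y
  | true, true, false => z
  | true, true, true => t

theorem sliceFamily_comm {α : Type*} (g h s y z t : α) (a b c : Bool) :
    sliceFamily g h s y z t b a c = sliceFamily g h s y z t a b c := by
  cases a <;> cases b <;> cases c <;> rfl

theorem sliceFamily_mem {α : Type*} {S : Finset α} {g h s y z t : α} (hg : g ∈ S) (hh : h ∈ S)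
    (hs : s ∈ S) (hy : y ∈ S) (hz : z ∈ S) (ht : t ∈ S) (a b c : Bool) :
    sliceFamily g h s y z t a b c ∈ S := by
  cases a <;> cases b <;> cases c <;> assumption

theorem sliceFamily_mono {α : Type*} [PartialOrder α] {g h s y z t : α} (hyt : y ≤ t) (hsy : s ≤ y)
    (hhy : h ≤ y) (hgh : g ≤ h) (hgs : g ≤ s) (hzt : z ≤ t) (hsz : s ≤ z) {a b c a' b' c' : Bool}
    (ha : a ≤ a') (hb : b ≤ b') (hc : c ≤ c') :
    sliceFamily g h s y z t a b c ≤ sliceFamily g h s y z t a' b' c' := by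
  cases a <;> cases b <;> cases c <;> cases a' <;> cases b' <;> cases c' <;>
    first
    | exact absurd ha (by decide)
    | exact absurd hb (by decide)
    | exact absurd hc (by decide)
    | (simp only [sliceFamily]; order)

theorem sliceWord_eq_sliceFamily
    (hf : ∀ x, f (x ∘ (Equiv.swap 0 1 : Equiv.Perm (Fin 8))) = f x) (a b c : Bool) :
    sliceFamily (sliceWord f false false false) (sliceWord f false false true)
      (sliceWord f false true false) (sliceWord f false true true)
      (sliceWord f true true false) (sliceWord f true true true) a b c = sliceWord f a b c := by
  have h (c : Bool) : sliceWord f false true c = sliceWord f true false c := by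
    funext k
    rw [sliceWord, sliceWord, ← hf, cubePoint_comp_swap]
  cases a <;> cases b <;> cases c
  exacts [rfl, rfl, rfl, rfl, h _, h _, rfl, rfl]

/-- The Boolean function with a given family of slices. -/
def ofSlices (w : Bool → Bool → Bool → ℕ → Bool) : (Fin 8 → Bool) → Bool :=
  fun v => w (v 0) (v 1) (v 2) (cubeIndex v)

variable {w : Bool → Bool → Bool → ℕ → Bool}

theorem ofSlices_sliceWord (f : (Fin 8 → Bool) → Bool) : ofSlices (sliceWord f) = f :=
  funext fun v => sliceWord_cubeIndex f v

theorem sliceWord_ofSlices (hw : ∀ a b c, w a b c ∈ Trie.words Trie.base) :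
    sliceWord (ofSlices w) = w := by
  funext a b c k
  rw [sliceWord]
  rcases lt_or_ge k 32 with hk | hk
  · rw [decide_eq_true hk, Bool.true_and, ofSlices, cubeIndex_cubePoint a b c hk]
    rfl
  · rw [decide_eq_false (not_lt.2 hk), Bool.false_and,
      ((Trie.mem_words_base _).1 (hw a b c)).1 k hk]

theorem monotone_ofSlices (hw : ∀ a b c, w a b c ∈ Trie.words Trie.base)
    (hmono : ∀ {a b c a' b' c'}, a ≤ a' → b ≤ b' → c ≤ c' → w a b c ≤ w a' b' c') :
    Monotone (ofSlices w) := fun _ _ h =>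
  (hmono (h 0) (h 1) (h 2) _).trans
    (Bool.le_iff_imp.2 (((Trie.mem_words_base _).1 (hw _ _ _)).2 _ _ (cubeIndex_land h)))

theorem ofSlices_comp_swap (hw : ∀ a b c, w b a c = w a b c) (v : Fin 8 → Bool) :
    ofSlices w (v ∘ (Equiv.swap 0 1 : Equiv.Perm (Fin 8))) = ofSlices w v := by
  have := cubePoint_comp_swap (v 0) (v 1) (v 2) (cubeIndex v)
  rw [cubePoint_cubeIndex] at this
  rw [this, ofSlices, cubeIndex_cubePoint _ _ _ (cubeIndex_lt v)]
  exact congrFun (hw _ _ _) _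

/-- A monotone Boolean function invariant under the exchange of the first two coordinates is
determined by six of its slices. -/
noncomputable def invariantEquivSliceTuples :
    {f : (Fin 8 → Bool) → Bool //
      Monotone f ∧ ∀ x : Fin 8 → Bool, f (x ∘ (Equiv.swap 0 1 : Equiv.Perm (Fin 8))) = f x} ≃
    {p // p ∈ sliceTuples Trie.base} where
  toFun f := ⟨(sliceWord f.1 false true false, sliceWord f.1 true true true,
      sliceWord f.1 false true true, sliceWord f.1 false false true,
      sliceWord f.1 false false false, sliceWord f.1 true true false), by
    have h (a b c) := sliceWord_mem_words f.2.1 a b c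
    simp [sliceTuples, h, sliceWord_mono f.2.1]⟩
  invFun p := ⟨ofSlices (sliceFamily p.1.2.2.2.2.1 p.1.2.2.2.1 p.1.1 p.1.2.2.1 p.1.2.2.2.2.2
      p.1.2.1), by
    obtain ⟨⟨s, t, y, h, g, z⟩, hp⟩ := p
    simp only [sliceTuples, Finset.mem_filter, Finset.mem_product] at hp
    obtain ⟨⟨hs, ht, hy, hh, hg, hz⟩, hyt, hsy, hhy, hgh, hgs, hzt, hsz⟩ := hp
    exact ⟨monotone_ofSlices (sliceFamily_mem hg hh hs hy hz ht)
      (sliceFamily_mono hyt hsy hhy hgh hgs hzt hsz),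
      ofSlices_comp_swap (sliceFamily_comm g h s y z t)⟩⟩
  left_inv f := Subtype.ext <| (congrArg ofSlices <| funext fun a => funext fun b => funext fun c =>
    sliceWord_eq_sliceFamily f.2.2 a b c).trans (ofSlices_sliceWord f.1)
  right_inv p := Subtype.ext <| by
    obtain ⟨⟨s, t, y, h, g, z⟩, hp⟩ := p
    simp only [sliceTuples, Finset.mem_filter, Finset.mem_product] at hp
    obtain ⟨⟨hs, ht, hy, hh, hg, hz⟩, -⟩ := hp
    simp only [sliceWord_ofSlices (sliceFamily_mem hg hh hs hy hz ht), sliceFamily]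

end Slices

/-- The number of monotone Boolean functions of 8 variables fixed by the
permutation (0 1) equals 101627867809333596. -/
theorem card_fixed_mbf :
    Nat.card {f : (Fin 8 → Bool) → Bool //
      Monotone f ∧ ∀ x : Fin 8 → Bool, f (x ∘ (Equiv.swap 0 1 : Equiv.Perm (Fin 8))) = f x} = 101627867809333596 := by
  rw [Nat.card_congr invariantEquivSliceTuples, Nat.subtype_card _ fun _ => Iff.rfl,
    card_sliceTuples, Trie.sum_tupleCount_base]
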